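/- Let α, β be Martin-Löf random left-c.e. reals. If D(α,β) > 1, then α − β is a Martin-Löf random right-c.e. real. -/

import Mathlib

open Filter MeasureTheory Set

/-- A real is left-c.e. if it is the limit of a computable increasing sequence of rationals. -/
def LeftCE (x : ℝ) : Prop :=
  ∃ f : ℕ → ℚ, Computable f ∧ Monotone f ∧
    Tendsto (fun n => (f n : ℝ)) atTop (nhds x)

/-- A real is right-c.e. if it is the limit of a computable decreasing sequence of rationals. -/
def RightCE (x : ℝ) : Prop :=
  ∃ f : ℕ → ℚ, Computable f ∧ Antitone f ∧
    Tendsto (fun n => (f n : ℝ)) atTop (nhds x)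

/-- The Σ⁰₁ class of reals given by level `i` of the computable enumeration `g` of
rational open intervals. -/
def testSet (g : ℕ → ℕ → ℚ × ℚ) (i : ℕ) : Set ℝ :=
  ⋃ n, Set.Ioo (((g i n).1 : ℝ)) (((g i n).2 : ℝ))

/-- A real is Martin-Löf random if for every Martin-Löf test, i.e. every uniformly c.e.
sequence of Σ⁰₁ classes `(U_i)` with `μ(U_i) ≤ 2⁻¹ ^ i`, the real avoids some level of
the test. -/
def MLRandom (x : ℝ) : Prop :=
  ∀ g : ℕ → ℕ → ℚ × ℚ, Computable₂ g →
    (∀ i, volume (testSet g i) ≤ 2⁻¹ ^ i) →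
    ∃ i, x ∉ testSet g i

/-- `DD α β` is the infimum of the positive rationals `q` such that `qα - β` is a
left-c.e. real. -/
noncomputable def DD (a b : ℝ) : ℝ :=
  sInf {x : ℝ | ∃ q : ℚ, 0 < q ∧ x = (q : ℝ) ∧ LeftCE ((q : ℝ) * a - b)}

/-- `DDstar α β` is the supremum of the positive rationals `q` such that `qα - β` is a
right-c.e. real. -/
noncomputable def DDstar (a b : ℝ) : ℝ :=
  sSup {x : ℝ | ∃ q : ℚ, 0 < q ∧ x = (q : ℝ) ∧ RightCE ((q : ℝ) * a - b)}

open Encodable Denumerable in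
theorem rat_enc (q : ℚ) : @encode ℚ (inferInstance : Primcodable ℚ).toEncodable q =
    (List.range (Rat.instEncodable.encode q)).countP
      (fun y => @decide (y ∈ Set.range Rat.instEncodable.encode)
        (@decidableRangeEncode ℚ Rat.instEncodable y)) := by
  rfl

def rcode (q : ℚ) : ℕ := Nat.pair (Encodable.encode q.num) q.den

theorem rcode_eq (q : ℚ) : Rat.instEncodable.encode q = rcode q := rfl

def okc (m : ℕ) : Prop :=
  0 < m.unpair.2 ∧ ∀ x < m.unpair.2 + 1,
    ((m.unpair.1 + 1) / 2 % x = 0 → m.unpair.2 % x = 0 → x = 1)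

instance : DecidablePred okc := fun m => by unfold okc; infer_instance

theorem int_enc_ofNat (n : ℕ) : Encodable.encode (n : ℤ) = 2 * n := by rfl

theorem int_enc_negSucc (n : ℕ) : Encodable.encode (Int.negSucc n) = 2 * n + 1 := by rfl

theorem int_enc_natAbs (z : ℤ) : (Encodable.encode z + 1) / 2 = z.natAbs := by
  cases z with
  | ofNat n =>
    have := int_enc_ofNat n
    simp only [Int.ofNat_eq_natCast, Int.natAbs_natCast] at *
    omega
  | negSucc n =>
    rw [int_enc_negSucc]; simp only [Int.natAbs_negSucc]; omega

theorem okc_iff (m : ℕ) : okc m ↔ m ∈ Set.range rcode := by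
  constructor
  · rintro ⟨h1, h2⟩
    refine ⟨⟨Denumerable.ofNat ℤ m.unpair.1, m.unpair.2, h1.ne', ?_⟩, ?_⟩
    · rw [← int_enc_natAbs, Denumerable.encode_ofNat]
      exact h2 _ (Nat.lt_succ_of_le (Nat.gcd_le_right _ h1))
        (Nat.mod_eq_zero_of_dvd (Nat.gcd_dvd_left _ _))
        (Nat.mod_eq_zero_of_dvd (Nat.gcd_dvd_right _ _))
    · show Nat.pair (Encodable.encode (Denumerable.ofNat ℤ m.unpair.1)) m.unpair.2 = m
      rw [Denumerable.encode_ofNat, Nat.pair_unpair]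
  · rintro ⟨q, rfl⟩
    refine ⟨by simpa [rcode] using q.pos, ?_⟩
    intro x _ hx hy
    simp only [rcode, Nat.unpair_pair, int_enc_natAbs] at hx hy
    exact Nat.eq_one_of_dvd_coprimes q.reduced (Nat.dvd_of_mod_eq_zero hx)
      (Nat.dvd_of_mod_eq_zero hy)

theorem okc_prim : PrimrecPred okc := by
  have hu1 : Primrec (fun m : ℕ => m.unpair.1) := Primrec.fst.comp Primrec.unpair
  have hu2 : Primrec (fun m : ℕ => m.unpair.2) := Primrec.snd.comp Primrec.unpair
  have hR : PrimrecRel (fun (x m : ℕ) =>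
      ((m.unpair.1 + 1) / 2 % x = 0 → m.unpair.2 % x = 0 → x = 1)) := by
    have a1 : PrimrecPred (fun p : ℕ × ℕ => (p.2.unpair.1 + 1) / 2 % p.1 = 0) :=
      Primrec.eq.comp (Primrec.nat_mod.comp (Primrec.nat_div.comp
        (Primrec.succ.comp (hu1.comp Primrec.snd)) (Primrec.const 2)) Primrec.fst)
        (Primrec.const 0)
    have a2 : PrimrecPred (fun p : ℕ × ℕ => p.2.unpair.2 % p.1 = 0) :=
      Primrec.eq.comp (Primrec.nat_mod.comp (hu2.comp Primrec.snd) Primrec.fst)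
        (Primrec.const 0)
    have a3 : PrimrecPred (fun p : ℕ × ℕ => p.1 = 1) :=
      Primrec.eq.comp Primrec.fst (Primrec.const 1)
    have := (a1.not.or (a2.not.or a3))
    exact PrimrecPred.of_eq this (fun p => by tauto)
  have h2 := PrimrecRel.comp (PrimrecRel.forall_lt hR) (Primrec.succ.comp hu2) Primrec.id
  have h1 : PrimrecPred (fun m : ℕ => 0 < m.unpair.2) :=
    Primrec.nat_lt.comp (Primrec.const 0) hu2
  exact PrimrecPred.of_eq (h1.and h2) (fun p => by rfl)

def cntc (m : ℕ) : ℕ := ((List.range m).filter (fun x => decide (okc x))).length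

theorem cntc_prim : Primrec cntc :=
  Primrec.list_length.comp ((Primrec.listFilter okc_prim).comp Primrec.list_range)

def renc (q : ℚ) : ℕ := @Encodable.encode ℚ Primcodable.toEncodable q

theorem renc_inj {x y : ℚ} (h : renc x = renc y) : x = y :=
  @Encodable.encode_injective ℚ Primcodable.toEncodable x y h

theorem renc_prim : Primrec renc := Primrec.encode

theorem rat_enc' (q : ℚ) : renc q = cntc (rcode q) := by
  refine (rat_enc q).trans ?_
  rw [List.countP_eq_length_filter, rcode_eq, cntc]
  congr 1
  apply List.filter_congr
  intro x _
  simp only [decide_eq_decide]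
  rw [okc_iff]; rfl

/-- functions into the rationals with decidable graph are computable -/
theorem comp_of_graph {α β : Type*} [Primcodable α] [Denumerable β] {F : α → β}
    {r : α → β → Bool} (hr : Computable₂ r) (h : ∀ a z, r a z = true ↔ z = F a) :
    Computable F := by
  have h1 : Computable₂ (fun (a : α) (n : ℕ) => r a (Denumerable.ofNat β n)) :=
    hr.comp Computable.fst ((Computable.ofNat β).comp Computable.snd)
  have h2 : Partrec (fun a => (Nat.rfind (fun n => Part.some (r a (Denumerable.ofNat β n)))).map
      (Denumerable.ofNat β)) :=
    (Partrec.rfind (p := fun a => fun n => Part.some (r a (Denumerable.ofNat β n)))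
      h1.partrec₂).map ((Computable.ofNat β).comp Computable.snd)
  refine Partrec.of_eq_tot h2 ?_
  intro a
  rw [Part.mem_map_iff]
  refine ⟨Encodable.encode (F a), ?_, by simp⟩
  refine Nat.mem_rfind.2 ⟨?_, ?_⟩
  · simp only [Denumerable.ofNat_encode, Part.mem_some_iff]
    exact ((h a (F a)).2 rfl).symm
  · intro m hm
    simp only [Part.mem_some_iff]
    by_contra hc
    have h3 : r a (Denumerable.ofNat β m) = true := by simpa using Ne.symm hc
    have h4 := (h _ _).1 h3
    rw [← h4] at hm
    simp at hm

theorem cntc_inj {m n : ℕ} (hm : okc m) (hn : okc n) (h : cntc m = cntc n) : m = n := by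
  obtain ⟨x, rfl⟩ := (okc_iff m).1 hm
  obtain ⟨y, rfl⟩ := (okc_iff n).1 hn
  rw [← rat_enc', ← rat_enc'] at h
  rw [renc_inj h]

theorem rcode_comp : Computable rcode := by
  have h1 : PrimrecPred (fun p : ℚ × ℕ => okc p.2 ∧ cntc p.2 = renc p.1) :=
    (okc_prim.comp Primrec.snd).and
      (Primrec.eq.comp (cntc_prim.comp Primrec.snd) (renc_prim.comp Primrec.fst))
  refine comp_of_graph (r := fun q m => decide (okc m ∧ cntc m = renc q))
    (Primrec.to_comp h1.decide) ?_
  intro q m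
  simp only [decide_eq_true_eq]
  have hq : okc (rcode q) := (okc_iff _).2 ⟨q, rfl⟩
  constructor
  · rintro ⟨h1, h2⟩
    rw [rat_enc'] at h2
    exact cntc_inj h1 hq h2
  · rintro rfl
    exact ⟨hq, (rat_enc' q).symm⟩

/-- positive part of numerator, negative part of numerator, denominator -/
def rp (q : ℚ) : ℕ := q.num.toNat
def rn (q : ℚ) : ℕ := (-q.num).toNat

theorem rden_comp : Computable (fun q : ℚ => q.den) :=
  ((Computable.snd.comp Computable.unpair).comp rcode_comp).of_eq (fun q => by simp [rcode])

theorem renc_comp : Computable (fun q : ℚ => Encodable.encode q.num) :=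
  ((Computable.fst.comp Computable.unpair).comp rcode_comp).of_eq (fun q => by simp [rcode])

theorem int_enc_toNat (z : ℤ) : (bif (Encodable.encode z) % 2 == 0 then
    (Encodable.encode z) / 2 else 0) = z.toNat := by
  cases z with
  | ofNat n =>
    have := int_enc_ofNat n
    simp only [Int.ofNat_eq_natCast] at *
    rw [this]; simp
  | negSucc n =>
    rw [int_enc_negSucc]
    have : (2 * n + 1) % 2 = 1 := by omega
    simp [this]

theorem int_enc_toNat_neg (z : ℤ) : (bif (Encodable.encode z) % 2 == 0 then
    0 else (Encodable.encode z + 1) / 2) = (-z).toNat := by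
  cases z with
  | ofNat n =>
    have := int_enc_ofNat n
    simp only [Int.ofNat_eq_natCast] at *
    rw [this]; simp
  | negSucc n =>
    rw [int_enc_negSucc]
    have : (2 * n + 1) % 2 = 1 := by omega
    simp [this]
    omega

theorem rp_comp : Computable rp := by
  have h : Primrec (fun k : ℕ => bif k % 2 == 0 then k / 2 else 0) :=
    Primrec.cond (Primrec.beq.comp (Primrec.nat_mod.comp Primrec.id (Primrec.const 2))
      (Primrec.const 0)) (Primrec.nat_div.comp Primrec.id (Primrec.const 2)) (Primrec.const 0)
  exact (h.to_comp.comp renc_comp).of_eq (fun q => int_enc_toNat _)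

theorem rn_comp : Computable rn := by
  have h : Primrec (fun k : ℕ => bif k % 2 == 0 then 0 else (k + 1) / 2) :=
    Primrec.cond (Primrec.beq.comp (Primrec.nat_mod.comp Primrec.id (Primrec.const 2))
      (Primrec.const 0)) (Primrec.const 0)
      (Primrec.nat_div.comp (Primrec.succ.comp Primrec.id) (Primrec.const 2))
  exact (h.to_comp.comp renc_comp).of_eq (fun q => int_enc_toNat_neg _)

theorem rat_rep (q : ℚ) : q = ((rp q : ℚ) - rn q) / q.den := by
  have h : ((rp q : ℤ) - rn q) = q.num := by unfold rp rn; omega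
  have h' : ((rp q : ℚ) - rn q) = q.num := by exact_mod_cast h
  rw [h', Rat.num_div_den]

section
variable {α : Type*} [Primcodable α]

theorem cadd {f g : α → ℕ} (hf : Computable f) (hg : Computable g) :
    Computable (fun a => f a + g a) := Primrec.nat_add.to_comp.comp hf hg
theorem cmul {f g : α → ℕ} (hf : Computable f) (hg : Computable g) :
    Computable (fun a => f a * g a) := Primrec.nat_mul.to_comp.comp hf hg
theorem clt {f g : α → ℕ} (hf : Computable f) (hg : Computable g) :
    Computable (fun a => decide (f a < g a)) :=
  Primrec.nat_lt.decide.to_comp.comp hf hg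
theorem ceq {f g : α → ℕ} (hf : Computable f) (hg : Computable g) :
    Computable (fun a => decide (f a = g a)) :=
  (Primrec.eq (α := ℕ)).decide.to_comp.comp hf hg

theorem qlt {f g : α → ℚ} (hf : Computable f) (hg : Computable g) :
    Computable (fun a => decide (f a < g a)) := by
  refine (clt (cadd (cmul (rp_comp.comp hf) (rden_comp.comp hg))
      (cmul (rn_comp.comp hg) (rden_comp.comp hf)))
    (cadd (cmul (rp_comp.comp hg) (rden_comp.comp hf))
      (cmul (rn_comp.comp hf) (rden_comp.comp hg)))).of_eq ?_
  intro a
  rw [decide_eq_decide]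
  have h1 : (0 : ℚ) < (f a).den := by exact_mod_cast (f a).pos
  have h2 : (0 : ℚ) < (g a).den := by exact_mod_cast (g a).pos
  conv_rhs => rw [rat_rep (f a), rat_rep (g a), div_lt_div_iff₀ h1 h2]
  rw [← Nat.cast_lt (α := ℚ)]
  push_cast
  constructor <;> intro h <;> linarith

theorem qadd₂ : Computable₂ (fun x y : ℚ => x + y) := by
  have hx : Computable (fun p : (ℚ × ℚ) × ℚ => p.1.1) := Computable.fst.comp Computable.fst
  have hy : Computable (fun p : (ℚ × ℚ) × ℚ => p.1.2) := Computable.snd.comp Computable.fst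
  have hz : Computable (fun p : (ℚ × ℚ) × ℚ => p.2) := Computable.snd
  refine comp_of_graph (F := fun p : ℚ × ℚ => p.1 + p.2)
    (ceq (cadd (cadd (cmul (rp_comp.comp hx) (cmul (rden_comp.comp hy) (rden_comp.comp hz)))
        (cmul (rp_comp.comp hy) (cmul (rden_comp.comp hx) (rden_comp.comp hz))))
        (cmul (rn_comp.comp hz) (cmul (rden_comp.comp hx) (rden_comp.comp hy))))
      (cadd (cadd (cmul (rn_comp.comp hx) (cmul (rden_comp.comp hy) (rden_comp.comp hz)))
        (cmul (rn_comp.comp hy) (cmul (rden_comp.comp hx) (rden_comp.comp hz))))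
        (cmul (rp_comp.comp hz) (cmul (rden_comp.comp hx) (rden_comp.comp hy))))).to₂ ?_
  rintro ⟨x, y⟩ z
  simp only [decide_eq_true_eq]
  have h1 : (x.den : ℚ) ≠ 0 := by exact_mod_cast x.den_nz
  have h2 : (y.den : ℚ) ≠ 0 := by exact_mod_cast y.den_nz
  have h3 : (z.den : ℚ) ≠ 0 := by exact_mod_cast z.den_nz
  conv_rhs => rw [rat_rep x, rat_rep y, rat_rep z]
  rw [← Nat.cast_inj (R := ℚ)]
  push_cast
  field_simp
  constructor <;> intro h <;> linarith

theorem qmul₂ : Computable₂ (fun x y : ℚ => x * y) := by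
  have hx : Computable (fun p : (ℚ × ℚ) × ℚ => p.1.1) := Computable.fst.comp Computable.fst
  have hy : Computable (fun p : (ℚ × ℚ) × ℚ => p.1.2) := Computable.snd.comp Computable.fst
  have hz : Computable (fun p : (ℚ × ℚ) × ℚ => p.2) := Computable.snd
  refine comp_of_graph (F := fun p : ℚ × ℚ => p.1 * p.2)
    (ceq (cadd (cmul (cadd (cmul (rp_comp.comp hx) (rp_comp.comp hy))
        (cmul (rn_comp.comp hx) (rn_comp.comp hy))) (rden_comp.comp hz))
        (cmul (rn_comp.comp hz) (cmul (rden_comp.comp hx) (rden_comp.comp hy))))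
      (cadd (cmul (cadd (cmul (rp_comp.comp hx) (rn_comp.comp hy))
        (cmul (rn_comp.comp hx) (rp_comp.comp hy))) (rden_comp.comp hz))
        (cmul (rp_comp.comp hz) (cmul (rden_comp.comp hx) (rden_comp.comp hy))))).to₂ ?_
  rintro ⟨x, y⟩ z
  simp only [decide_eq_true_eq]
  have h1 : (x.den : ℚ) ≠ 0 := by exact_mod_cast x.den_nz
  have h2 : (y.den : ℚ) ≠ 0 := by exact_mod_cast y.den_nz
  have h3 : (z.den : ℚ) ≠ 0 := by exact_mod_cast z.den_nz
  conv_rhs => rw [rat_rep x, rat_rep y, rat_rep z]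
  rw [← Nat.cast_inj (R := ℚ)]
  push_cast
  field_simp
  constructor <;> intro h <;> linarith

theorem qadd {f g : α → ℚ} (hf : Computable f) (hg : Computable g) :
    Computable (fun a => f a + g a) := qadd₂.comp hf hg
theorem qmul {f g : α → ℚ} (hf : Computable f) (hg : Computable g) :
    Computable (fun a => f a * g a) := qmul₂.comp hf hg
theorem qneg {f : α → ℚ} (hf : Computable f) : Computable (fun a => - f a) :=
  (qmul (Computable.const (-1)) hf).of_eq (fun a => by ring)
theorem qsub {f g : α → ℚ} (hf : Computable f) (hg : Computable g) :
    Computable (fun a => f a - g a) := (qadd hf (qneg hg)).of_eq (fun a => by ring)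
theorem cite {σ : Type*} [Primcodable σ] {p : α → Prop} [DecidablePred p] {f g : α → σ}
    (hp : Computable (fun a => decide (p a)))
    (hf : Computable f) (hg : Computable g) : Computable (fun a => if p a then f a else g a) :=
  (Computable.cond hp hf hg).of_eq (fun a => by by_cases h : p a <;> simp [h])
theorem cand {p q : α → Prop} [DecidablePred p] [DecidablePred q]
    (hp : Computable (fun a => decide (p a))) (hq : Computable (fun a => decide (q a))) :
    Computable (fun a => decide (p a ∧ q a)) :=
  (Primrec.and.to_comp.comp hp hq).of_eq (fun a => by simp)
end
section KS

def stepf (c : ℕ → ℕ → ℚ) (e : ℕ → ℚ) (t i : ℕ) (S S' : ℚ × ℚ × ℚ) : ℚ × ℚ × ℚ :=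
  let w' : ℚ := if i = 0 then c 1 (t + 1) - c 1 0 else
    if c (i - 1) (t + 1) < S'.2.2 then S.1 + (c (i - 1) (t + 1) - c (i - 1) t) else S.1
  if c i (t + 1) < S.2.2 then (w', S.2.1, S.2.2)
  else (w', w', c i (t + 1) + e i * (w' - S.2.1))

def st (c : ℕ → ℕ → ℚ) (e : ℕ → ℚ) : ℕ → ℕ → ℚ × ℚ × ℚ
  | 0, i => (0, 0, c i 0)
  | t + 1, i => stepf c e t i (st c e t i) (st c e t (i - 1))

variable {c : ℕ → ℕ → ℚ} {e : ℕ → ℚ}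

theorem stepf_comp {α : Type*} [Primcodable α] (hc : Computable₂ c) (he : Computable e)
    {t i : α → ℕ} {S S' : α → ℚ × ℚ × ℚ} (ht : Computable t) (hi : Computable i)
    (hS : Computable S) (hS' : Computable S') :
    Computable (fun a => stepf c e (t a) (i a) (S a) (S' a)) := by
  have ht1 : Computable (fun a => t a + 1) := Computable.succ.comp ht
  have hi1 : Computable (fun a => i a - 1) := Computable.pred.comp hi
  have hR : Computable (fun a => (S a).2.2) := Computable.snd.comp (Computable.snd.comp hS)
  have hR' : Computable (fun a => (S' a).2.2) := Computable.snd.comp (Computable.snd.comp hS')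
  have hM : Computable (fun a => (S a).2.1) := Computable.fst.comp (Computable.snd.comp hS)
  have hW : Computable (fun a => (S a).1) := Computable.fst.comp hS
  have hw : Computable (fun a => (if i a = 0 then c 1 (t a + 1) - c 1 0 else
    if c (i a - 1) (t a + 1) < (S' a).2.2 then
      (S a).1 + (c (i a - 1) (t a + 1) - c (i a - 1) (t a)) else (S a).1 : ℚ)) := by
    refine cite (ceq hi (Computable.const 0))
      (qsub (hc.comp (Computable.const 1) ht1) (Computable.const _)) ?_
    exact cite (qlt (hc.comp hi1 ht1) hR')
      (qadd hW (qsub (hc.comp hi1 ht1) (hc.comp hi1 ht))) hW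
  exact cite (qlt (hc.comp hi ht1) hR) (hw.pair (hM.pair hR))
    (hw.pair (hw.pair (qadd (hc.comp hi ht1) (qmul (he.comp hi) (qsub hw hM)))))

theorem st_comp (hc : Computable₂ c) (he : Computable e) : Computable₂ (st c e) := by
  have key : Computable₂ (fun (_ : Unit) (n : ℕ) => st c e n.unpair.1 n.unpair.2) := by
    refine Computable.nat_strong_rec _
      (g := fun _ l => Nat.casesOn (l.length.unpair.1)
        (some ((0 : ℚ), (0 : ℚ), c l.length.unpair.2 0))
        (fun t => (l[Nat.pair t l.length.unpair.2]?).bind (fun S =>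
          (l[Nat.pair t (l.length.unpair.2 - 1)]?).map (fun S' =>
            stepf c e t l.length.unpair.2 S S')))) ?_ ?_
    · have hl : Computable (fun p : Unit × List (ℚ × ℚ × ℚ) => p.2.length) :=
        Computable.list_length.comp Computable.snd
      have h1 : Computable (fun p : Unit × List (ℚ × ℚ × ℚ) => p.2.length.unpair.1) :=
        Computable.fst.comp (Computable.unpair.comp hl)
      have h2 : Computable (fun p : Unit × List (ℚ × ℚ × ℚ) => p.2.length.unpair.2) :=
        Computable.snd.comp (Computable.unpair.comp hl)
      have hpair : Computable₂ Nat.pair := Primrec₂.natPair.to_comp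
      refine Computable.nat_casesOn h1 ?_ ?_
      · exact Computable.option_some.comp ((Computable.const _).pair
          ((Computable.const _).pair (hc.comp h2 (Computable.const 0))))
      · refine Computable.option_bind ?_ ?_
        · exact Computable.list_getElem?.comp (Computable.snd.comp Computable.fst)
            (hpair.comp Computable.snd (h2.comp Computable.fst))
        · refine Computable.option_map ?_ ?_
          · exact Computable.list_getElem?.comp
              ((Computable.snd.comp Computable.fst).comp Computable.fst)
              (hpair.comp (Computable.snd.comp Computable.fst)
                (Computable.pred.comp ((h2.comp Computable.fst).comp Computable.fst)))
          · exact stepf_comp hc he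
              ((Computable.snd.comp Computable.fst).comp Computable.fst)
              (((h2.comp Computable.fst).comp Computable.fst).comp Computable.fst)
              (Computable.snd.comp Computable.fst) Computable.snd
    · intro _ n
      simp only [List.length_map, List.length_range]
      obtain ⟨t, i, rfl⟩ : ∃ t i, n = Nat.pair t i := ⟨n.unpair.1, n.unpair.2, by simp⟩
      simp only [Nat.unpair_pair]
      cases t with
      | zero => simp [st]
      | succ t =>
        have l1 : Nat.pair t i < Nat.pair (t + 1) i := Nat.pair_lt_pair_left i (Nat.lt_succ_self t)
        have l2 : Nat.pair t (i - 1) < Nat.pair (t + 1) i := by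
          refine lt_of_le_of_lt ?_ l1
          rcases Nat.eq_zero_or_pos i with h | h
          · subst h; simp
          · exact (Nat.pair_lt_pair_right t (by omega)).le
        simp [l1, l2, st]
  have h3 : Computable₂ (fun t i : ℕ => st c e (Nat.pair t i).unpair.1 (Nat.pair t i).unpair.2) :=
    key.comp (Computable.const ()) (Primrec₂.natPair.to_comp.comp Computable.fst Computable.snd)
  exact Computable.of_eq h3 (fun p => by simp)

variable (c e) in
def sW (i t : ℕ) : ℚ := (st c e t i).1
variable (c e) in
def sM (i t : ℕ) : ℚ := (st c e t i).2.1
variable (c e) in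
def sR (i t : ℕ) : ℚ := (st c e t i).2.2

theorem sW_zero (i : ℕ) : sW c e i 0 = 0 := rfl
theorem sM_zero (i : ℕ) : sM c e i 0 = 0 := rfl
theorem sR_zero (i : ℕ) : sR c e i 0 = c i 0 := rfl

theorem sW_lev0 (t : ℕ) : sW c e 0 t = c 1 t - c 1 0 := by
  cases t with
  | zero => simp [sW_zero]
  | succ t =>
    simp only [sW, st, stepf]
    split_ifs <;> simp_all

theorem sW_succ (i t : ℕ) : sW c e (i + 1) (t + 1) =
    if c i (t + 1) < sR c e i t then sW c e (i + 1) t + (c i (t + 1) - c i t)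
    else sW c e (i + 1) t := by
  simp only [sW, sR, st, stepf]
  by_cases h : c i (t + 1) < (st c e t i).2.2 <;>
    by_cases h1 : c (i + 1) (t + 1) < (st c e t (i + 1)).2.2 <;> simp [h, h1]

theorem sM_succ (i t : ℕ) : sM c e i (t + 1) =
    if c i (t + 1) < sR c e i t then sM c e i t else sW c e i (t + 1) := by
  simp only [sW, sM, sR, st, stepf]
  split_ifs <;> simp_all

theorem sR_succ (i t : ℕ) : sR c e i (t + 1) =
    if c i (t + 1) < sR c e i t then sR c e i t
    else c i (t + 1) + e i * (sW c e i (t + 1) - sM c e i t) := by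
  simp only [sW, sM, sR, st, stepf]
  split_ifs <;> simp_all

theorem sW_mono (hm : ∀ i, Monotone (c i)) (i : ℕ) : Monotone (sW c e i) := by
  cases i with
  | zero => intro s t h; rw [sW_lev0, sW_lev0]; linarith [hm 1 h]
  | succ i =>
    refine monotone_nat_of_le_succ (fun t => ?_)
    rw [sW_succ]
    split_ifs
    · linarith [hm i (Nat.le_succ t)]
    · exact le_rfl

theorem sM_le (hm : ∀ i, Monotone (c i)) (i t : ℕ) : sM c e i t ≤ sW c e i t := by
  induction t with
  | zero => simp [sW_zero, sM_zero]
  | succ t ih =>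
    rw [sM_succ]
    split_ifs
    · exact ih.trans (sW_mono hm i (Nat.le_succ t))
    · exact le_rfl

theorem sM_mono (hm : ∀ i, Monotone (c i)) (i : ℕ) : Monotone (sM c e i) := by
  refine monotone_nat_of_le_succ (fun t => ?_)
  rw [sM_succ]
  split_ifs
  · exact le_rfl
  · exact (sM_le hm i t).trans (sW_mono hm i (Nat.le_succ t))

theorem s_inv (hm : ∀ i, Monotone (c i)) (he : ∀ i, 0 ≤ e i) (i t : ℕ) :
    sW c e (i + 1) t + max (sR c e i t - c i t) 0 ≤ e i * sM c e i t := by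
  induction t with
  | zero => simp [sW_zero, sM_zero, sR_zero]
  | succ t ih =>
    rw [sW_succ, sM_succ, sR_succ]
    have h1 := hm i (Nat.le_succ t)
    have h2 := (sM_le (e := e) hm i t).trans (sW_mono hm i (Nat.le_succ t))
    have h3 : 0 ≤ e i * (sW c e i (t + 1) - sM c e i t) :=
      mul_nonneg (he i) (sub_nonneg.2 h2)
    have h4 := le_max_left (sR c e i t - c i t) 0
    have h5 := le_max_right (sR c e i t - c i t) 0
    split_ifs with h
    · rw [max_eq_left (by linarith)]
      linarith
    · rw [add_sub_cancel_left, max_eq_left h3]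
      linarith

theorem sW_le (hm : ∀ i, Monotone (c i)) (he : ∀ i, 0 ≤ e i) (i t : ℕ) :
    sW c e (i + 1) t ≤ e i * sW c e i t := by
  have h1 := s_inv hm he i t
  have h2 := le_max_right (sR c e i t - c i t) 0
  have h3 := mul_le_mul_of_nonneg_left (sM_le (e := e) hm i t) (he i)
  linarith

theorem s_vol (hm : ∀ i, Monotone (c i)) (he : ∀ i, 0 ≤ e i) (i : ℕ) (B : ℝ)
    (hB : ∀ t, ((e i * sM c e i t : ℚ) : ℝ) ≤ B) :
    volume (⋃ t, Set.Ioo ((c i t : ℚ) : ℝ) ((sR c e i t : ℚ) : ℝ)) ≤ ENNReal.ofReal B := by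
  rw [measure_iUnion_eq_iSup_accumulate]
  refine iSup_le (fun N => ?_)
  refine le_trans ?_ (ENNReal.ofReal_le_ofReal (hB N))
  induction N with
  | zero => simp [Set.accumulate_def, sR_zero]
  | succ N ih =>
    rw [Set.accumulate_succ, sR_succ, sM_succ]
    have h1 := hm i (Nat.le_succ N)
    have h2 := (sM_le (e := e) hm i N).trans (sW_mono hm i (Nat.le_succ N))
    have h3 : 0 ≤ e i * (sW c e i (N + 1) - sM c e i N) :=
      mul_nonneg (he i) (sub_nonneg.2 h2)
    have h0 : 0 ≤ e i * sM c e i N := by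
      have : sM c e i 0 ≤ _ := sM_mono (e := e) hm i (Nat.zero_le N)
      rw [sM_zero] at this
      exact mul_nonneg (he i) this
    split_ifs with h
    · refine le_trans (measure_mono ?_) ih
      refine Set.union_subset le_rfl ?_
      refine Set.Subset.trans ?_ (Set.subset_accumulate (x := N))
      exact Set.Ioo_subset_Ioo_left (by exact_mod_cast h1)
    · refine (measure_union_le _ _).trans ?_
      refine (add_le_add_left ih _).trans ?_
      rw [Real.volume_Ioo, ← ENNReal.ofReal_add (by exact_mod_cast h0)]
      · apply ENNReal.ofReal_le_ofReal
        push_cast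
        linarith
      · push_cast at *
        have : (0 : ℝ) ≤ ((e i * (sW c e i (N + 1) - sM c e i N) : ℚ) : ℝ) := by exact_mod_cast h3
        push_cast at this
        linarith

theorem sZ_mono (i : ℕ) : Monotone (fun t => sR c e i t - e i * sM c e i t) := by
  refine monotone_nat_of_le_succ (fun t => ?_)
  simp only [sR_succ, sM_succ]
  split_ifs with h
  · exact le_rfl
  · push Not at h
    linarith

theorem leftCE_of_freq (hcc : Computable₂ c) (hec : Computable e)
    (hm : ∀ i, Monotone (c i)) (i : ℕ) (x y : ℝ)
    (hx : Tendsto (fun t => ((c i t : ℚ) : ℝ)) atTop (nhds x))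
    (hy : Tendsto (fun t => ((sW c e i t : ℚ) : ℝ)) atTop (nhds y))
    (hf : ∃ᶠ t in atTop, ¬ c i (t + 1) < sR c e i t) : LeftCE (x - e i * y) := by
  obtain ⟨φ, hφ, hφ'⟩ := Filter.extraction_of_frequently_atTop hf
  have hφt : Tendsto (fun n => φ n + 1) atTop atTop :=
    (tendsto_add_atTop_nat 1).comp hφ.tendsto_atTop
  have hst : Computable (fun t => st c e t i) := (st_comp hcc hec).comp Computable.id
    (Computable.const i)
  have hMt : Tendsto (fun t => ((sM c e i t : ℚ) : ℝ)) atTop (nhds y) := by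
    have hmono : Monotone (fun t => ((sM c e i t : ℚ) : ℝ)) :=
      fun s t h => Rat.cast_le.2 (sM_mono (e := e) hm i h)
    rw [tendsto_iff_tendsto_subseq_of_monotone hmono hφt]
    refine (hy.comp hφt).congr (fun n => ?_)
    simp only [Function.comp]
    rw [sM_succ, if_neg (hφ' n)]
  refine ⟨fun t => sR c e i t - e i * sM c e i t, ?_, sZ_mono i, ?_⟩
  · exact qsub (Computable.snd.comp (Computable.snd.comp hst))
      (qmul (Computable.const _) (Computable.fst.comp (Computable.snd.comp hst)))
  · have hmono : Monotone (fun t => ((sR c e i t - e i * sM c e i t : ℚ) : ℝ)) :=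
      fun s t h => Rat.cast_le.2 (sZ_mono (c := c) (e := e) i h)
    rw [tendsto_iff_tendsto_subseq_of_monotone hmono hφt]
    have h1 : Tendsto (fun n => ((c i (φ n + 1) : ℚ) : ℝ) - e i * ((sM c e i (φ n) : ℚ) : ℝ))
        atTop (nhds (x - e i * y)) :=
      (hx.comp hφt).sub ((hMt.comp hφ.tendsto_atTop).const_mul _)
    refine h1.congr (fun n => ?_)
    simp only [Function.comp]
    rw [sR_succ, sM_succ, if_neg (hφ' n), if_neg (hφ' n)]
    push_cast
    ring

end KS

theorem LeftCE.add_const {x : ℝ} (h : LeftCE x) (k : ℚ) : LeftCE (x + k) := by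
  obtain ⟨f, h1, h2, h3⟩ := h
  refine ⟨fun n => f n + k, qadd h1 (Computable.const _), fun s t hst => ?_, ?_⟩
  · have := h2 hst
    simpa using this
  · push_cast
    exact h3.add_const _

theorem LeftCE.add {x y : ℝ} (h : LeftCE x) (h' : LeftCE y) : LeftCE (x + y) := by
  obtain ⟨f, h1, h2, h3⟩ := h
  obtain ⟨g, h4, h5, h6⟩ := h'
  refine ⟨fun n => f n + g n, qadd h1 h4, h2.add h5, ?_⟩
  push_cast
  exact h3.add h6

theorem LeftCE.smul {x : ℝ} (h : LeftCE x) (k : ℚ) (hk : 0 ≤ k) : LeftCE (k * x) := by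
  obtain ⟨f, h1, h2, h3⟩ := h
  refine ⟨fun n => k * f n, qmul (Computable.const _) h1,
    fun s t hst => mul_le_mul_of_nonneg_left (h2 hst) hk, ?_⟩
  push_cast
  exact h3.const_mul _
theorem qpow_comp (p : ℚ) : Computable (fun i : ℕ => p ^ i) := by
  have h := Computable.nat_rec (α := ℕ) (σ := ℚ) (f := fun i => i) (g := fun _ => 1)
    (h := fun _ y => y.2 * p) Computable.id (Computable.const 1)
    (qmul (Computable.snd.comp Computable.snd) (Computable.const p))
  refine h.of_eq (fun i => ?_)
  induction i with
  | zero => simp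
  | succ i ih =>
    simp only at ih ⊢
    rw [ih, pow_succ]

theorem MLRandom.ne_rat {x : ℝ} (h : MLRandom x) (k : ℚ) : x ≠ k := by
  rintro rfl
  have hp : Computable (fun p : ℕ × ℕ => (1 / 2 : ℚ) ^ (p.1 + 1)) :=
    (qpow_comp (1 / 2)).comp (Computable.succ.comp Computable.fst)
  obtain ⟨i, hi⟩ := h (fun i _ => (k - (1 / 2) ^ (i + 1), k + (1 / 2) ^ (i + 1)))
    ((qsub (Computable.const k) hp).pair (qadd (Computable.const k) hp)) (by
      intro i
      simp only [testSet, Set.iUnion_const]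
      rw [Real.volume_Ioo]
      push_cast
      have : ((k : ℝ) + (1 / 2) ^ (i + 1) - (k - (1 / 2) ^ (i + 1))) = (2⁻¹) ^ i := by
        rw [pow_succ]; simp; ring
      rw [this, ENNReal.ofReal_pow (by norm_num), ENNReal.ofReal_inv_of_pos (by norm_num)]
      simp)
  apply hi
  simp only [testSet, Set.iUnion_const, Set.mem_Ioo]
  have : (0 : ℚ) < (1 / 2) ^ (i + 1) := by positivity
  constructor
  · exact_mod_cast (by linarith : k - (1 / 2) ^ (i + 1) < k)
  · exact_mod_cast (by linarith : k < k + (1 / 2) ^ (i + 1))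

section KS2
variable {c : ℕ → ℕ → ℚ} {e : ℕ → ℚ}

theorem ks_A (hcc : Computable₂ c) (hec : Computable e)
    (hm : ∀ i, Monotone (c i)) (x : ℕ → ℝ)
    (hx : ∀ i, Tendsto (fun t => ((c i t : ℚ) : ℝ)) atTop (nhds (x i)))
    (hno : ∀ i, ¬ LeftCE (x i - e i * x (i + 1))) (i : ℕ)
    (h : ∃ k : ℚ, ∀ᶠ t in atTop, sW c e i t = c (i + 1) t - k) :
    ∀ᶠ t in atTop, c i (t + 1) < sR c e i t := by
  obtain ⟨k, hk⟩ := h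
  by_contra hf
  have hy : Tendsto (fun t => ((sW c e i t : ℚ) : ℝ)) atTop (nhds (x (i + 1) - k)) := by
    refine ((hx (i + 1)).sub_const (k : ℝ)).congr' ?_
    filter_upwards [hk] with t ht
    rw [ht]; push_cast; ring
  have h1 := leftCE_of_freq hcc hec hm i _ _ (hx i) hy (not_eventually.1 hf)
  have h2 := h1.add_const (- (e i * k))
  apply hno i
  convert h2 using 1
  push_cast; ring

theorem ks_B (i : ℕ) (h : ∀ᶠ t in atTop, c i (t + 1) < sR c e i t) :
    ∃ k : ℚ, ∀ᶠ t in atTop, sW c e (i + 1) t = c i t - k := by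
  obtain ⟨N, hN⟩ := eventually_atTop.1 h
  refine ⟨c i N - sW c e (i + 1) N, eventually_atTop.2 ⟨N, fun t ht => ?_⟩⟩
  induction t, ht using Nat.le_induction with
  | base => ring
  | succ t ht ih =>
    rw [sW_succ, if_pos (hN t ht), ih]; ring

theorem ks_C (x : ℕ → ℝ)
    (hx : ∀ i, Tendsto (fun t => ((c i t : ℚ) : ℝ)) atTop (nhds (x i))) (i : ℕ)
    (h : ∀ᶠ t in atTop, c i (t + 1) < sR c e i t) :
    ∃ N, x i ≤ sR c e i N := by
  obtain ⟨N, hN⟩ := eventually_atTop.1 h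
  have hc : ∀ t, N ≤ t → sR c e i t = sR c e i N := by
    intro t ht
    induction t, ht using Nat.le_induction with
    | base => rfl
    | succ t ht ih => rw [sR_succ, if_pos (hN t ht), ih]
  refine ⟨N, le_of_tendsto ((hx i).comp (tendsto_add_atTop_nat 1)) ?_⟩
  filter_upwards [eventually_ge_atTop N] with t ht
  have := hN t ht
  rw [hc t ht] at this
  simp only [Function.comp]
  exact_mod_cast this.le

theorem ks_all (hcc : Computable₂ c) (hec : Computable e)
    (hm : ∀ i, Monotone (c i)) (x : ℕ → ℝ)
    (hx : ∀ i, Tendsto (fun t => ((c i t : ℚ) : ℝ)) atTop (nhds (x i)))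
    (hno : ∀ i, ¬ LeftCE (x i - e i * x (i + 1))) (hper : ∀ i, c (i + 2) = c i) (i : ℕ) :
    ∃ k : ℚ, ∀ᶠ t in atTop, sW c e i t = c (i + 1) t - k := by
  induction i with
  | zero => exact ⟨c 1 0, Eventually.of_forall (fun t => sW_lev0 t)⟩
  | succ i ih =>
    rw [hper]
    exact ks_B i (ks_A hcc hec hm x hx hno i ih)

end KS2

theorem main_lemma (a b : ℝ) (ha : LeftCE a) (hb : LeftCE b) (har : MLRandom a)
    (r q : ℚ) (hr : 0 < r) (hrq : r < q) (hq : ¬ LeftCE ((q : ℝ) * a - b)) :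
    LeftCE (b - r * a) := by
  by_contra hno
  obtain ⟨f, f1, f2, f3⟩ := ha
  obtain ⟨g, g1, g2, g3⟩ := hb
  have hq0 : 0 < q := hr.trans hrq
  set c : ℕ → ℕ → ℚ := fun i t => if i % 2 = 0 then g t else f t with hc
  set e : ℕ → ℚ := fun i => if i % 2 = 0 then r else 1 / q with he
  set x : ℕ → ℝ := fun i => if i % 2 = 0 then b else a with hxd
  have hmod : Computable (fun i : ℕ => i % 2) :=
    Primrec.to_comp (Primrec.nat_mod.comp Primrec.id (Primrec.const 2))
  have hec : Computable e :=
    cite (ceq hmod (Computable.const 0)) (Computable.const _) (Computable.const _)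
  have hcc : Computable₂ c :=
    cite (p := fun z : ℕ × ℕ => z.1 % 2 = 0)
      (ceq (hmod.comp Computable.fst) (Computable.const 0)) (g1.comp Computable.snd)
      (f1.comp Computable.snd)
  have he0 : ∀ i, 0 ≤ e i := by
    intro i; simp only [he]; split_ifs <;> positivity
  have hm : ∀ i, Monotone (c i) := by
    intro i
    by_cases h : i % 2 = 0 <;> simp only [hc, h] <;> simpa
  have hx : ∀ i, Tendsto (fun t => ((c i t : ℚ) : ℝ)) atTop (nhds (x i)) := by
    intro i
    by_cases h : i % 2 = 0 <;> simp only [hc, hxd, h] <;> simpa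
  have hper : ∀ i, c (i + 2) = c i := by
    intro i; ext t; simp [hc]
  have hno' : ∀ i, ¬ LeftCE (x i - e i * x (i + 1)) := by
    intro i
    by_cases h : i % 2 = 0
    · have h' : (i + 1) % 2 = 1 := by omega
      simpa [hxd, he, h, h'] using hno
    · have h' : (i + 1) % 2 = 0 := by omega
      have h : i % 2 = 1 := by omega
      intro hh
      apply hq
      have h3 := hh.smul q hq0.le
      convert h3 using 1
      have : (q : ℝ) ≠ 0 := by exact_mod_cast hq0.ne'
      simp [hxd, he, h, h']
      field_simp
  have hall := fun i => ks_A hcc hec hm x hx hno' i (ks_all hcc hec hm x hx hno' hper i)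
  obtain ⟨C, hC⟩ : ∃ C : ℚ, a - f 0 ≤ C := ⟨_, (exists_rat_gt (a - f 0)).choose_spec.le⟩
  have hle : ∀ t, (f t : ℝ) ≤ a := fun t => by
    refine ge_of_tendsto f3 ?_
    filter_upwards [eventually_ge_atTop t] with s hs
    exact_mod_cast f2 hs
  have hC0 : 0 ≤ C := by
    have := hle 0
    exact_mod_cast (by linarith : (0 : ℝ) ≤ C)
  set θ : ℚ := r / q with hθ
  have hθ0 : 0 ≤ θ := by positivity
  have hθ1 : θ < 1 := (div_lt_one hq0).2 hrq
  have hW : ∀ j t, sW c e (2 * j) t ≤ θ ^ j * C := by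
    intro j
    induction j with
    | zero =>
      intro t
      rw [Nat.mul_zero, sW_lev0]
      have := hle t
      have h0 : c 1 = f := by ext t; simp [hc]
      rw [h0, pow_zero, one_mul]
      exact_mod_cast (by linarith : (f t : ℝ) - f 0 ≤ C)
    | succ j ih =>
      intro t
      have h1 := sW_le (e := e) hm he0 (2 * j) t
      have h2 := sW_le (e := e) hm he0 (2 * j + 1) t
      have e1 : e (2 * j) = r := by simp [he]
      have e2 : e (2 * j + 1) = 1 / q := by
        have : (2 * j + 1) % 2 = 1 := by omega
        simp [he]
      rw [e1] at h1
      rw [e2] at h2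
      have h3 := mul_le_mul_of_nonneg_left h1 (by positivity : 0 ≤ 1 / q)
      have h4 := mul_le_mul_of_nonneg_left (ih t) hθ0
      have h5 : 1 / q * (r * sW c e (2 * j) t) = θ * sW c e (2 * j) t := by rw [hθ]; ring
      have : 2 * (j + 1) = 2 * j + 1 + 1 := by ring
      rw [this, pow_succ]
      linarith
  have hM : ∀ j t, e (2 * j + 1) * sM c e (2 * j + 1) t ≤ θ ^ j * C := by
    intro j t
    have h1 := sW_le (e := e) hm he0 (2 * j) t
    have h2 := sM_le (e := e) hm (2 * j + 1) t
    have e1 : e (2 * j) = r := by simp [he]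
    have e2 : e (2 * j + 1) = 1 / q := by
      have : (2 * j + 1) % 2 = 1 := by omega
      simp [he]
    rw [e1] at h1
    rw [e2]
    have h3 := mul_le_mul_of_nonneg_left (h2.trans h1) (by positivity : 0 ≤ 1 / q)
    have h4 := mul_le_mul_of_nonneg_left (hW j t) hθ0
    have h5 : 1 / q * (r * sW c e (2 * j) t) = θ * sW c e (2 * j) t := by rw [hθ]; ring
    have h6 : θ * (θ ^ j * C) ≤ 1 * (θ ^ j * C) :=
      mul_le_mul_of_nonneg_right hθ1.le (by positivity)
    linarith
  obtain ⟨N, hN1, hN2⟩ : ∃ N : ℕ, θ ^ N ≤ 1 / 2 ∧ θ ^ N * C ≤ 1 := by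
    obtain ⟨N, hN⟩ := exists_pow_lt_of_lt_one (by positivity : 0 < min (1 / 2) (1 / (C + 1))) hθ1
    refine ⟨N, hN.le.trans (min_le_left _ _), ?_⟩
    have h1 := hN.le.trans (min_le_right _ _)
    calc θ ^ N * C ≤ 1 / (C + 1) * C := mul_le_mul_of_nonneg_right h1 hC0
      _ ≤ 1 := by
        rw [one_div, inv_mul_le_iff₀ (by positivity)]; linarith
  have hst := st_comp hcc hec
  have hidx : Computable (fun i : ℕ => 2 * (N * (i + 1)) + 1) :=
    Computable.succ.comp (cmul (Computable.const 2) (cmul (Computable.const N) Computable.succ))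
  obtain ⟨i, hi⟩ := har
    (fun i n => (c (2 * (N * (i + 1)) + 1) n, sR c e (2 * (N * (i + 1)) + 1) n))
    ((hcc.comp (hidx.comp Computable.fst) Computable.snd).pair
      (Computable.snd.comp (Computable.snd.comp
        (hst.comp Computable.snd (hidx.comp Computable.fst))))) (by
      intro i
      have hb : ∀ t, ((e (2 * (N * (i + 1)) + 1) * sM c e (2 * (N * (i + 1)) + 1) t : ℚ) : ℝ)
          ≤ (2⁻¹ : ℝ) ^ i := by
        intro t
        have h1 := hM (N * (i + 1)) t
        have h2 : θ ^ (N * (i + 1)) * C ≤ (1 / 2) ^ i := by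
          rw [pow_mul, pow_succ, mul_assoc]
          calc (θ ^ N) ^ i * (θ ^ N * C) ≤ (θ ^ N) ^ i * 1 :=
                mul_le_mul_of_nonneg_left hN2 (by positivity)
            _ ≤ (1 / 2) ^ i := by
                rw [mul_one]; exact pow_le_pow_left₀ (by positivity) hN1 i
        have h3 : ((e (2 * (N * (i + 1)) + 1) * sM c e (2 * (N * (i + 1)) + 1) t : ℚ) : ℝ)
            ≤ (((1 / 2) ^ i : ℚ) : ℝ) := by exact_mod_cast h1.trans h2
        refine h3.trans (le_of_eq ?_)
        push_cast; simp
      refine (s_vol hm he0 _ _ hb).trans (le_of_eq ?_)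
      rw [ENNReal.ofReal_pow (by norm_num), ENNReal.ofReal_inv_of_pos (by norm_num)]
      simp)
  apply hi
  set k := 2 * (N * (i + 1)) + 1 with hk
  have hk2 : k % 2 = 1 := by omega
  obtain ⟨n, hn⟩ := ks_C x hx k (hall k)
  have hxk : x k = a := by simp [hxd, hk2]
  have hck : c k n = f n := by simp [hc, hk2]
  rw [hxk] at hn
  refine mem_iUnion.2 ⟨n, ?_, ?_⟩
  · show ((c k n : ℚ) : ℝ) < a
    rw [hck]
    exact lt_of_le_of_ne (hle n) (har.ne_rat _).symm
  · exact lt_of_le_of_ne hn (har.ne_rat _)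
theorem lip_vol (f : ℝ → ℝ) (S T : Set ℝ) (k : ℝ) (hk : 0 < k) (hST : ∀ x ∈ S, f x ∈ T)
    (hf : ∀ x ∈ S, ∀ y ∈ S, x < y → k * (y - x) ≤ f x - f y) :
    volume S ≤ ENNReal.ofReal (1 / k) * volume T := by
  have habs : ∀ x ∈ S, ∀ y ∈ S, k * |x - y| ≤ |f x - f y| := by
    intro x hx y hy
    rcases lt_trichotomy x y with h | h | h
    · rw [abs_sub_comm x y, abs_of_pos (sub_pos.2 h)]
      exact (hf x hx y hy h).trans (le_abs_self _)
    · simp [h]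
    · rw [abs_sub_comm (f x), abs_of_pos (sub_pos.2 h)]
      exact (hf y hy x hx h).trans (le_abs_self _)
  have hinj : InjOn f S := by
    intro x hx y hy h
    have h1 := habs x hx y hy
    rw [h, sub_self, abs_zero] at h1
    have h2 : |x - y| ≤ 0 := by
      by_contra h3
      push Not at h3
      have := mul_pos hk h3
      linarith
    exact sub_eq_zero.1 (abs_nonpos_iff.1 h2)
  have hinv : LeftInvOn (Function.invFunOn f S) f S := hinj.leftInvOn_invFunOn
  have hL : LipschitzOnWith (Real.toNNReal (1 / k)) (Function.invFunOn f S) (f '' S) := by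
    apply LipschitzOnWith.of_dist_le_mul
    rintro _ ⟨x, hx, rfl⟩ _ ⟨y, hy, rfl⟩
    rw [hinv hx, hinv hy, Real.dist_eq, Real.dist_eq, Real.coe_toNNReal _ (by positivity),
      one_div, ← div_eq_inv_mul, le_div_iff₀ hk, mul_comm]
    exact habs x hx y hy
  have h1 := hL.hausdorffMeasure_image_le (d := 1) zero_le_one
  rw [hinv.image_image, hausdorffMeasure_real, ENNReal.rpow_one] at h1
  refine h1.trans ?_
  refine mul_le_mul' le_rfl (measure_mono ?_)
  rintro _ ⟨x, hx, rfl⟩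
  exact hST x hx

theorem demuth (a y : ℝ) (har : MLRandom a) (ha : LeftCE a) (hy : LeftCE y) (k : ℚ)
    (hk : 0 < k) : MLRandom (-(k * a + y)) := by
  intro g hg hvol
  obtain ⟨f, f1, f2, f3⟩ := ha
  obtain ⟨h, h1, h2, h3⟩ := hy
  by_contra hcon
  push Not at hcon
  have hkR : (0 : ℝ) < k := by exact_mod_cast hk
  obtain ⟨m, hm⟩ : ∃ m : ℕ, 1 / (k : ℝ) < 2 ^ m := pow_unbounded_of_one_lt _ (by norm_num)
  have hle : ∀ t, (f t : ℝ) ≤ a := fun t => by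
    refine ge_of_tendsto f3 ?_
    filter_upwards [eventually_ge_atTop t] with s hs
    exact_mod_cast f2 hs
  set G : ℕ → ℕ → ℚ × ℚ := fun i n =>
    if - (g (i + m) n.unpair.1).2 < k * f n.unpair.2 + h n.unpair.2 ∧
        k * f n.unpair.2 + h n.unpair.2 < - (g (i + m) n.unpair.1).1 then
      (f n.unpair.2, (1 / k) * (- (g (i + m) n.unpair.1).1 - h n.unpair.2))
    else (0, 0) with hG
  have hGc : Computable₂ G := by
    have u1 : Computable (fun p : ℕ × ℕ => p.2.unpair.1) :=
      Computable.fst.comp (Computable.unpair.comp Computable.snd)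
    have u2 : Computable (fun p : ℕ × ℕ => p.2.unpair.2) :=
      Computable.snd.comp (Computable.unpair.comp Computable.snd)
    have gg : Computable (fun p : ℕ × ℕ => g (p.1 + m) p.2.unpair.1) :=
      hg.comp (cadd Computable.fst (Computable.const m)) u1
    have hgam : Computable (fun p : ℕ × ℕ => k * f p.2.unpair.2 + h p.2.unpair.2) :=
      qadd (qmul (Computable.const k) (f1.comp u2)) (h1.comp u2)
    exact cite (cand (qlt (qneg (Computable.snd.comp gg)) hgam)
        (qlt hgam (qneg (Computable.fst.comp gg))))
      ((f1.comp u2).pair (qmul (Computable.const _)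
        (qsub (qneg (Computable.fst.comp gg)) (h1.comp u2)))) (Computable.const _)
  -- membership
  have hmem : ∀ i x, x ∈ testSet G i ↔ ∃ s n, - ((g (i + m) n).2 : ℝ) < k * f s + h s ∧
      (k * f s + h s : ℝ) < - ((g (i + m) n).1 : ℝ) ∧ (f s : ℝ) < x ∧
        k * x + h s < - ((g (i + m) n).1 : ℝ) := by
    intro i x
    have hdiv : ∀ (u v : ℝ), x < 1 / (k : ℝ) * (- u - v) ↔ k * x + v < - u := by
      intro u v
      rw [one_div, ← div_eq_inv_mul, lt_div_iff₀ hkR, mul_comm x]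
      constructor <;> intro h <;> linarith
    simp only [testSet, mem_iUnion]
    constructor
    · rintro ⟨n, hn⟩
      simp only [hG] at hn
      split_ifs at hn with hc
      · refine ⟨n.unpair.2, n.unpair.1, by exact_mod_cast hc.1, by exact_mod_cast hc.2,
          hn.1, ?_⟩
        have := hn.2
        push_cast at this
        exact (hdiv _ _).1 this
      · simp at hn
    · rintro ⟨s, n, c1, c2, c3, c4⟩
      refine ⟨Nat.pair n s, ?_⟩
      simp only [hG, Nat.unpair_pair]
      rw [if_pos ⟨by exact_mod_cast c1, by exact_mod_cast c2⟩]
      refine ⟨c3, ?_⟩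
      push_cast
      exact (hdiv _ _).2 c4
  obtain ⟨i, hi⟩ := har G hGc (by
    intro i
    classical
    let P : ℝ → ℕ → Prop := fun x s => ∃ n, - ((g (i + m) n).2 : ℝ) < k * f s + h s ∧
      (k * f s + h s : ℝ) < - ((g (i + m) n).1 : ℝ) ∧ (f s : ℝ) < x ∧
        k * x + h s < - ((g (i + m) n).1 : ℝ)
    have hP : ∀ x ∈ testSet G i, ∃ s, P x s := fun x hx => (hmem i x).1 hx
    let σ : ℝ → ℕ := fun x => if hx : ∃ s, P x s then Nat.find hx else 0
    have hσ : ∀ x ∈ testSet G i, P x (σ x) := by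
      intro x hx
      simp only [σ, dif_pos (hP x hx)]
      exact Nat.find_spec (hP x hx)
    have hσm : ∀ x ∈ testSet G i, ∀ s, P x s → σ x ≤ s := by
      intro x hx s hs
      simp only [σ, dif_pos (hP x hx)]
      exact Nat.find_min' (hP x hx) hs
    have hv := lip_vol (fun x => -(k * x + h (σ x))) (testSet G i) (testSet g (i + m)) k hkR
      (by
        intro x hx
        obtain ⟨n, c1, c2, c3, c4⟩ := hσ x hx
        refine mem_iUnion.2 ⟨n, ?_, ?_⟩
        · linarith
        · have := mul_lt_mul_of_pos_left c3 hkR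
          linarith)
      (by
        intro x hx z hz hxz
        have hs : σ x ≤ σ z := by
          by_contra hlt
          push Not at hlt
          obtain ⟨n, c1, c2, c3, c4⟩ := hσ z hz
          obtain ⟨_, _, _, d3, _⟩ := hσ x hx
          have : (f (σ z) : ℝ) ≤ f (σ x) := by exact_mod_cast f2 hlt.le
          have h5 := mul_lt_mul_of_pos_left hxz hkR
          have := hσm x hx (σ z) ⟨n, c1, c2, by linarith, by linarith⟩
          omega
        have : (h (σ x) : ℝ) ≤ h (σ z) := by exact_mod_cast h2 hs
        linarith)
    refine hv.trans ?_
    calc ENNReal.ofReal (1 / k) * volume (testSet g (i + m))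
        ≤ ENNReal.ofReal (2 ^ m) * 2⁻¹ ^ (i + m) :=
          mul_le_mul' (ENNReal.ofReal_le_ofReal hm.le) (hvol _)
      _ = 2⁻¹ ^ i := by
          rw [ENNReal.ofReal_pow (by norm_num), pow_add, mul_comm, mul_assoc, ← mul_pow]
          rw [ENNReal.ofReal_ofNat, ENNReal.inv_mul_cancel (by norm_num) (by norm_num)]
          simp)
  apply hi
  obtain ⟨n, hn1, hn2⟩ := mem_iUnion.1 (hcon (i + m))
  have hlim : Tendsto (fun s => (k * f s + h s : ℝ)) atTop (nhds (k * a + y)) :=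
    (f3.const_mul _).add h3
  have hhle : ∀ t, (h t : ℝ) ≤ y := fun t => by
    refine ge_of_tendsto h3 ?_
    filter_upwards [eventually_ge_atTop t] with s hs
    exact_mod_cast h2 hs
  obtain ⟨s, hs⟩ := (hlim.eventually (lt_mem_nhds
    (by linarith : - ((g (i + m) n).2 : ℝ) < k * a + y))).exists
  have hfa : (f s : ℝ) < a := lt_of_le_of_ne (hle s) (har.ne_rat _).symm
  have h5 := mul_lt_mul_of_pos_left hfa hkR
  have h6 := hhle s
  exact (hmem i a).2 ⟨s, n, hs, by linarith, hfa, by linarith⟩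

/-- Let `α, β` be Martin-Löf random left-c.e. reals. If `D(α,β) > 1`, then `α - β` is a
Martin-Löf random right-c.e. real. -/
theorem D_gt_one (a b : ℝ) (ha : LeftCE a) (har : MLRandom a)
    (hb : LeftCE b) (hbr : MLRandom b) (h : 1 < DD a b) :
    RightCE (a - b) ∧ MLRandom (a - b) := by
  obtain ⟨r, hr1, hr2⟩ := exists_rat_btwn h
  obtain ⟨q, hq1, hq2⟩ := exists_rat_btwn hr2
  have hr1' : 1 < r := by exact_mod_cast hr1
  have hq1' : r < q := by exact_mod_cast hq1
  have hq : ¬ LeftCE ((q : ℝ) * a - b) := by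
    intro hl
    have : DD a b ≤ q := by
      refine csInf_le ⟨0, ?_⟩ ⟨q, by linarith, rfl, hl⟩
      rintro _ ⟨p, hp, rfl, _⟩
      exact_mod_cast hp.le
    linarith
  have hm := main_lemma a b ha hb har r q (by linarith) hq1' hq
  have e : a - b = -(((r - 1 : ℚ) : ℝ) * a + (b - r * a)) := by push_cast; ring
  constructor
  · obtain ⟨f, f1, f2, f3⟩ := (ha.smul (r - 1) (by linarith)).add hm
    refine ⟨fun n => - f n, qneg f1, f2.neg, ?_⟩
    rw [e]
    push_cast at f3 ⊢
    exact f3.neg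
  · rw [e]
    exact demuth a _ har ha hm (r - 1) (by linarith)
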